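/- Let C be a nonsingular cubic surface in ℙ³(ℂ) containing four pairwise skew twistor lines a₁, a₂, a₃, a₄. If ℓ is any line in ℙ³(ℂ) meeting all four of a₁, a₂, a₃, a₄, then ℓ lies on C, the line j(ℓ) also lies on C and meets all four of a₁, a₂, a₃, a₄, and j(ℓ) ≠ ℓ. -/

import Mathlib

noncomputable section

open MvPolynomial

/-- The standard twistor structure `j : ℂ⁴ → ℂ⁴`,
`j(z₁,z₂,z₃,z₄) = (−z̄₂, z̄₁, −z̄₄, z̄₃)`. -/
def J : (Fin 4 → ℂ) → (Fin 4 → ℂ) :=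
  fun z => ![-(starRingEnd ℂ) (z 1), (starRingEnd ℂ) (z 0),
             -(starRingEnd ℂ) (z 3), (starRingEnd ℂ) (z 2)]

/-- A line in `ℙ³(ℂ)`: a 2-dimensional `ℂ`-subspace of `ℂ⁴`. -/
def IsLine (W : Submodule ℂ (Fin 4 → ℂ)) : Prop := Module.finrank ℂ W = 2

/-- A twistor line: a line whose underlying subspace satisfies `j(W) = W`. -/
def IsTwistorLine (W : Submodule ℂ (Fin 4 → ℂ)) : Prop :=
  IsLine W ∧ J '' (W : Set (Fin 4 → ℂ)) = (W : Set (Fin 4 → ℂ))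

/-- A polynomial vanishes identically on a subspace. -/
def VanishesOn (f : MvPolynomial (Fin 4) ℂ) (W : Submodule ℂ (Fin 4 → ℂ)) : Prop :=
  ∀ z ∈ W, eval z f = 0

/-- The surface `{f = 0}` is nonsingular: no nonzero point of `ℂ⁴` is a common zero of
`f` and all its partial derivatives. -/
def Nonsingular (f : MvPolynomial (Fin 4) ℂ) : Prop :=
  ∀ z : Fin 4 → ℂ, z ≠ 0 → eval z f = 0 → ∃ i, eval z (pderiv i f) ≠ 0

theorem J_J (z : Fin 4 → ℂ) : J (J z) = -z := by
  ext i; fin_cases i <;> simp [J]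

theorem J_smul_add_smul (x y : ℂ) (u w : Fin 4 → ℂ) :
    J (x • u + y • w) = starRingEnd ℂ x • J u + starRingEnd ℂ y • J w := by
  ext i; fin_cases i <;> simp [J] <;> ring

theorem J_smul (x : ℂ) (u : Fin 4 → ℂ) : J (x • u) = starRingEnd ℂ x • J u := by
  simpa using J_smul_add_smul x 0 u 0

theorem J_ne_zero {z : Fin 4 → ℂ} (hz : z ≠ 0) : J z ≠ 0 := by
  intro h
  have h' := J_J z
  rw [h] at h'
  apply hz
  rw [← neg_eq_zero, ← h']
  ext i; fin_cases i <;> simp [J]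

theorem J_ne_smul {z : Fin 4 → ℂ} (hz : z ≠ 0) (c : ℂ) : J z ≠ c • z := by
  intro h
  have h' := J_J z
  rw [h, J_smul, h, smul_smul, ← Complex.normSq_eq_conj_mul_self] at h'
  have h2 : ((Complex.normSq c : ℂ) + 1) • z = 0 := by
    rw [add_smul, h', one_smul, neg_add_cancel]
  rcases smul_eq_zero.1 h2 with h3 | h3
  · have h4 : Complex.normSq c + 1 = 0 := by exact_mod_cast h3
    linarith [Complex.normSq_nonneg c]
  · exact hz h3

theorem linearIndependent_pair_J {z : Fin 4 → ℂ} (hz : z ≠ 0) :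
    LinearIndependent ℂ ![z, J z] :=
  (LinearIndependent.pair_iff' hz).2 fun c h => J_ne_smul hz c h.symm

theorem IsLine.exists_eq_smul_add_smul {L : Submodule ℂ (Fin 4 → ℂ)} (hL : IsLine L)
    {u w : Fin 4 → ℂ} (hu : u ∈ L) (hw : w ∈ L) (h : LinearIndependent ℂ ![u, w])
    {z : Fin 4 → ℂ} (hz : z ∈ L) : ∃ x y : ℂ, x • u + y • w = z := by
  have hle : Submodule.span ℂ {u, w} ≤ L :=
    Submodule.span_le.2 (Set.insert_subset hu (Set.singleton_subset_iff.2 hw))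
  have hfin : Module.finrank ℂ (Submodule.span ℂ {u, w}) = Module.finrank ℂ L := by
    have := finrank_span_eq_card h
    rw [Matrix.range_cons_cons_empty, Fintype.card_fin] at this
    rw [this, hL]
  rw [← Submodule.eq_of_le_of_finrank_eq hle hfin] at hz
  exact Submodule.mem_span_pair.1 hz

/-- Two lines sharing two independent vectors are equal. -/
theorem IsLine.eq_of_linearIndependent {L M : Submodule ℂ (Fin 4 → ℂ)} (hL : IsLine L)
    (hM : IsLine M) {u w : Fin 4 → ℂ} (huL : u ∈ L) (hwL : w ∈ L) (huM : u ∈ M) (hwM : w ∈ M)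
    (h : LinearIndependent ℂ ![u, w]) : L = M := by
  apply le_antisymm <;> intro z hz
  · obtain ⟨x, y, rfl⟩ := hL.exists_eq_smul_add_smul huL hwL h hz
    exact M.add_mem (M.smul_mem _ huM) (M.smul_mem _ hwM)
  · obtain ⟨x, y, rfl⟩ := hM.exists_eq_smul_add_smul huM hwM h hz
    exact L.add_mem (L.smul_mem _ huL) (L.smul_mem _ hwL)

theorem eval_smul_of_isHomogeneous {σ R : Type*} [CommSemiring R] {f : MvPolynomial σ R}
    {n : ℕ} (hf : f.IsHomogeneous n) (c : R) (z : σ → R) : eval (c • z) f = c ^ n * eval z f := by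
  simp only [eval_eq, Finset.mul_sum, Pi.smul_apply, smul_eq_mul, mul_pow, Finset.prod_mul_distrib]
  refine Finset.sum_congr rfl fun d hd => ?_
  rw [Finset.prod_pow_eq_pow_sum, hf.degree_eq_sum_deg_support hd]
  ring

/-- The restriction of a cubic form to a line is a binary cubic form. -/
theorem exists_binary_cubic {σ : Type*} {f : MvPolynomial σ ℂ} (hf : f.IsHomogeneous 3)
    (u w : σ → ℂ) : ∃ A B C D : ℂ, ∀ x y : ℂ,
      eval (x • u + y • w) f = A * x ^ 3 + B * x ^ 2 * y + C * x * y ^ 2 + D * y ^ 3 := by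
  set p : Polynomial ℂ :=
    aeval (fun i => Polynomial.C (u i) + Polynomial.C (w i) * Polynomial.X) f
  have hdeg : p.natDegree < 4 := by
    have h1 : p.natDegree ≤ f.totalDegree * 1 :=
      MvPolynomial.aeval_natDegree_le f le_rfl _ fun i => by compute_degree
    have h2 := hf.totalDegree_le
    omega
  have heval (t : ℂ) : p.eval t = eval (u + t • w) f := by
    have h : (Polynomial.evalRingHom t).comp
        (aeval (R := ℂ) fun i => Polynomial.C (u i) + Polynomial.C (w i) * Polynomial.X).toRingHom
        = eval (u + t • w) := by
      apply MvPolynomial.ringHom_ext <;> intro i <;> simp [mul_comm t]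
    exact DFunLike.congr_fun h f
  refine ⟨p.coeff 0, p.coeff 1, p.coeff 2, p.coeff 3, fun x y => ?_⟩
  have hcont : Continuous fun x : ℂ => eval (x • u + y • w) f :=
    (MvPolynomial.continuous_eval f).comp (by fun_prop)
  refine congrFun (hcont.ext_on (dense_compl_singleton 0) (g := fun x => p.coeff 0 * x ^ 3
    + p.coeff 1 * x ^ 2 * y + p.coeff 2 * x * y ^ 2 + p.coeff 3 * y ^ 3) (by fun_prop) ?_) x
  intro x (hx : x ≠ 0)
  have h : x • u + y • w = x • (u + (y / x) • w) := by
    rw [smul_add, smul_smul, mul_div_cancel₀ _ hx]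
  simp only [h, eval_smul_of_isHomogeneous hf, ← heval,
    Polynomial.eval_eq_sum_range' hdeg, Finset.sum_range_succ, Finset.sum_range_zero]
  field_simp
  ring

/-- A cubic form vanishing at four distinct points of a line vanishes on the line. -/
theorem eval_eq_zero_of_four_points {σ : Type*} {f : MvPolynomial σ ℂ} (hf : f.IsHomogeneous 3)
    {u w : σ → ℂ} {α β γ δ : ℂ} (hα : α ≠ 0) (hβ : β ≠ 0) (hγ : γ ≠ 0) (hδ : δ ≠ 0)
    (hdet : α * δ - β * γ ≠ 0) (hu : eval u f = 0) (hw : eval w f = 0)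
    (h₁ : eval (α • u + β • w) f = 0) (h₂ : eval (γ • u + δ • w) f = 0) (x y : ℂ) :
    eval (x • u + y • w) f = 0 := by
  obtain ⟨A, B, C, D, h⟩ := exists_binary_cubic hf u w
  have hA : A = 0 := by simpa [hu] using (h 1 0).symm
  have hD : D = 0 := by simpa [hw] using (h 0 1).symm
  rw [h] at h₁ h₂ ⊢
  subst hA hD
  have e₁ : B * α + C * β = 0 := by
    apply mul_left_cancel₀ (mul_ne_zero hα hβ)
    linear_combination h₁
  have e₂ : B * γ + C * δ = 0 := by
    apply mul_left_cancel₀ (mul_ne_zero hγ hδ)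
    linear_combination h₂
  have hB : B = 0 := by
    apply mul_left_cancel₀ hdet
    linear_combination δ * e₁ - β * e₂
  have hC : C = 0 := by
    apply mul_left_cancel₀ hdet
    linear_combination α * e₂ - γ * e₁
  simp [hB, hC]

/-- If a nonsingular cubic surface contains four pairwise skew twistor lines
`a₁,a₂,a₃,a₄` and `ℓ` is a line meeting all four, then `ℓ` lies on the surface,
`j(ℓ)` lies on the surface and meets all four, and `j(ℓ) ≠ ℓ`. -/
theorem transversal_line_and_J_image (f : MvPolynomial (Fin 4) ℂ) (hf0 : f ≠ 0)
    (hhom : f.IsHomogeneous 3) (hns : Nonsingular f)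
    (a : Fin 4 → Submodule ℂ (Fin 4 → ℂ))
    (ha : ∀ i, IsTwistorLine (a i)) (hav : ∀ i, VanishesOn f (a i))
    (hskew : ∀ i j, i ≠ j → a i ⊓ a j = ⊥)
    (L : Submodule ℂ (Fin 4 → ℂ)) (hL : IsLine L)
    (hmeet : ∀ i, L ⊓ a i ≠ ⊥) :
    VanishesOn f L ∧
    (∀ z ∈ L, eval (J z) f = 0) ∧
    (∀ i, ∃ z ∈ L, J z ≠ 0 ∧ J z ∈ a i) ∧
    J '' (L : Set (Fin 4 → ℂ)) ≠ (L : Set (Fin 4 → ℂ)) := by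
  have hJa (i) {z : Fin 4 → ℂ} (hz : z ∈ a i) : J z ∈ a i := by
    have h : J z ∈ J '' (a i : Set (Fin 4 → ℂ)) := ⟨z, hz, rfl⟩
    rwa [(ha i).2] at h
  choose v hv hv0 using fun i => Submodule.exists_mem_ne_zero_of_ne_bot (hmeet i)
  have hvL (i) : v i ∈ L := (hv i).1
  have hva (i) : v i ∈ a i := (hv i).2
  have hne {i j : Fin 4} (hij : i ≠ j) {c d : ℂ} (h : c • v i = d • v j) : c = 0 := by
    have hmem : c • v i ∈ a i ⊓ a j :=
      ⟨(a i).smul_mem _ (hva i), h ▸ (a j).smul_mem _ (hva j)⟩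
    rw [hskew i j hij, Submodule.mem_bot] at hmem
    exact (smul_eq_zero.1 hmem).resolve_right (hv0 i)
  have hne' {i j : Fin 4} (hij : i ≠ j) (d : ℂ) : d • v j ≠ v i := fun h =>
    one_ne_zero (hne hij (c := 1) (d := d) (by rw [one_smul, h]))
  have hind : LinearIndependent ℂ ![v 0, v 1] :=
    (LinearIndependent.pair_iff' (hv0 0)).2 fun c => hne' (by decide) c
  have hspan {z : Fin 4 → ℂ} (hz : z ∈ L) := hL.exists_eq_smul_add_smul (hvL 0) (hvL 1) hind hz
  obtain ⟨α, β, h₂⟩ := hspan (hvL 2)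
  obtain ⟨γ, δ, h₃⟩ := hspan (hvL 3)
  have hα : α ≠ 0 := by
    rintro rfl
    exact hne' (i := 2) (j := 1) (by decide) β (by simpa using h₂)
  have hβ : β ≠ 0 := by
    rintro rfl
    exact hne' (i := 2) (j := 0) (by decide) α (by simpa using h₂)
  have hγ : γ ≠ 0 := by
    rintro rfl
    exact hne' (i := 3) (j := 1) (by decide) δ (by simpa using h₃)
  have hδ : δ ≠ 0 := by
    rintro rfl
    exact hne' (i := 3) (j := 0) (by decide) γ (by simpa using h₃)
  have hdet : α * δ - β * γ ≠ 0 := by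
    intro h
    refine hδ (hne (i := 2) (j := 3) (by decide) (d := β) ?_)
    rw [← h₂, ← h₃, ← sub_eq_zero]
    linear_combination (norm := module) h • v 0
  refine ⟨fun z hz => ?_, fun z hz => ?_, fun i => ⟨v i, hvL i, J_ne_zero (hv0 i), hJa i (hva i)⟩,
    fun h => ?_⟩
  · obtain ⟨x, y, rfl⟩ := hspan hz
    exact eval_eq_zero_of_four_points hhom hα hβ hγ hδ hdet (hav 0 _ (hva 0)) (hav 1 _ (hva 1))
      (h₂ ▸ hav 2 _ (hva 2)) (h₃ ▸ hav 3 _ (hva 3)) x y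
  · obtain ⟨x, y, rfl⟩ := hspan hz
    rw [J_smul_add_smul]
    have hc {c : ℂ} (h : c ≠ 0) : starRingEnd ℂ c ≠ 0 := (map_ne_zero _).2 h
    refine eval_eq_zero_of_four_points hhom (hc hα) (hc hβ) (hc hγ) (hc hδ) ?_
      (hav 0 _ (hJa 0 (hva 0))) (hav 1 _ (hJa 1 (hva 1))) ?_ ?_ _ _
    · simpa using hc hdet
    · rw [← J_smul_add_smul, h₂]
      exact hav 2 _ (hJa 2 (hva 2))
    · rw [← J_smul_add_smul, h₃]
      exact hav 3 _ (hJa 3 (hva 3))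
  · have hJL : J (v 0) ∈ L := by
      rw [← SetLike.mem_coe, ← h]
      exact ⟨v 0, hvL 0, rfl⟩
    have hLa : L = a 0 := hL.eq_of_linearIndependent (ha 0).1 (hvL 0) hJL (hva 0)
      (hJa 0 (hva 0)) (linearIndependent_pair_J (hv0 0))
    exact hmeet 1 (hLa ▸ hskew 0 1 (by decide))
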